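/- arXiv:2207.03238 — 3 statements merged into one kernel-verified Lean document; each statement's English description precedes it below -/
import Mathlib

section
/- Fix 1 ≤ p < ∞ and a sequence ν = (ν_n)_{n∈ℕ} of positive reals with Σ_{n=1}^∞ ν_n < ∞, and let σ and K be the backward shift and the set {x ∈ ℓ^p(ν) : |x_n| ≤ 1 ∀n}. For 0 < ε ≤ ν_1^{1/p} and n ∈ ℕ, the set S = {x ∈ K : x_i ∈ {0, ε/ν_1^{1/p}, 2ε/ν_1^{1/p}, …, ⌊ν_1^{1/p}/ε⌋·ε/ν_1^{1/p}} for 1 ≤ i ≤ n, and x_i = 0 for i > n} has cardinality (⌊ν_1^{1/p}/ε⌋ + 1)^n and satisfies d_n(x,y) ≥ ε for all distinct x,y ∈ S (with d_n the dynamical metric of σ on K induced by ‖·‖_{ℓ^p(ν)}). Consequently mdim_M(K, σ, ‖·‖_{ℓ^p(ν)}) ≥ 1. -/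
open Filter Set MeasureTheory
open scoped ENNReal NNReal Topology

noncomputable section

variable {Y : Type*}

/-- The dynamical (Bowen) distance `d_n` associated to a distance function `d`. -/
def dynDist (d : Y → Y → ℝ) (f : Y → Y) (n : ℕ) (x y : Y) : ℝ :=
  ⨆ j : Fin n, d (f^[(j : ℕ)] x) (f^[(j : ℕ)] y)

/-- The `(n,ε)`-dynamical ball around `x`. -/
def dynBall (d : Y → Y → ℝ) (f : Y → Y) (n : ℕ) (ε : ℝ) (x : Y) : Set Y :=
  {y | dynDist d f n x y < ε}

/-- A set `E` is `(n,ε)`-separated if distinct points of `E` are at `d_n`-distance `> ε`. -/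
def IsDynSep (d : Y → Y → ℝ) (f : Y → Y) (n : ℕ) (ε : ℝ) (E : Set Y) : Prop :=
  E.Pairwise fun x y => ε < dynDist d f n x y

/-- Maximal cardinality of an `(n,ε)`-separated subset of `P`. -/
def sepMaxCard (d : Y → Y → ℝ) (f : Y → Y) (n : ℕ) (ε : ℝ) (P : Set Y) : ℕ :=
  sSup {m | ∃ E : Finset Y, ↑E ⊆ P ∧ IsDynSep d f n ε ↑E ∧ E.card = m}

/-- `h(f,ε) = limsup_n (1/n) log s(f,n,ε)` (computed inside `P`). -/
def hSep (d : Y → Y → ℝ) (f : Y → Y) (P : Set Y) (ε : ℝ) : EReal :=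
  Filter.limsup (fun n : ℕ => ((Real.log (sepMaxCard d f n ε P) / n : ℝ) : EReal)) Filter.atTop

/-- Upper metric mean dimension (separated-sets version). -/
def mdimSep (d : Y → Y → ℝ) (f : Y → Y) (P : Set Y) : EReal :=
  Filter.limsup (fun ε : ℝ => hSep d f P ε * (((|Real.log ε|)⁻¹ : ℝ) : EReal))
    (nhdsWithin (0 : ℝ) (Set.Ioi 0))

/-- The Carathéodory sum `m(Z,s,N,ε)`: infimum over countable covers of `Z` by dynamical
balls of lengths `≥ N` of `Σ exp(−s·n_i)`. -/
def mCover (d : Y → Y → ℝ) (f : Y → Y) (Z : Set Y) (s : ℝ) (N : ℕ) (ε : ℝ) : ℝ≥0∞ :=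
  ⨅ (Γ : Set (Y × ℕ)) (_ : Γ.Countable) (_ : ∀ q ∈ Γ, N ≤ q.2)
    (_ : Z ⊆ ⋃ q ∈ Γ, dynBall d f q.2 ε q.1),
      ∑' q : Γ, ENNReal.ofReal (Real.exp (-(s * ((q : Y × ℕ).2 : ℝ))))

/-- `m(Z,s,ε) = lim_{N→∞} m(Z,s,N,ε)` (a monotone limit, hence a supremum). -/
def mCarat (d : Y → Y → ℝ) (f : Y → Y) (Z : Set Y) (s : ℝ) (ε : ℝ) : ℝ≥0∞ :=
  ⨆ N : ℕ, mCover d f Z s N ε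

/-- `h(Z,f,ε) = inf {s : m(Z,s,ε) = 0}`. -/
def hCov (d : Y → Y → ℝ) (f : Y → Y) (Z : Set Y) (ε : ℝ) : ℝ :=
  sInf {s : ℝ | mCarat d f Z s ε = 0}

/-- Upper metric mean dimension of `f` on the (possibly non-compact) subset `Z`. -/
def mdimC (d : Y → Y → ℝ) (f : Y → Y) (Z : Set Y) : EReal :=
  Filter.limsup (fun ε : ℝ => ((hCov d f Z ε * (|Real.log ε|)⁻¹ : ℝ) : EReal))
    (nhdsWithin (0 : ℝ) (Set.Ioi 0))

/-- Birkhoff average `(1/n) Σ_{j<n} φ(f^j x)`. -/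
def birkhoff (f : Y → Y) (φ : Y → ℝ) (n : ℕ) (x : Y) : ℝ :=
  (∑ j ∈ Finset.range n, φ (f^[j] x)) / n

/-- The level set `K_α`. -/
def Kset (f : Y → Y) (φ : Y → ℝ) (α : ℝ) : Set Y :=
  {x | Filter.Tendsto (fun n : ℕ => birkhoff f φ n x) Filter.atTop (nhds α)}

/-- The set `P(α,δ,n)`. -/
def Pset (f : Y → Y) (φ : Y → ℝ) (α δ : ℝ) (n : ℕ) : Set Y :=
  {x | |birkhoff f φ n x - α| < δ}

/-- Minimal number of `(n,ε)`-dynamical balls needed to cover `P`. -/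
def coverMinCard (d : Y → Y → ℝ) (f : Y → Y) (n : ℕ) (ε : ℝ) (P : Set Y) : ℕ :=
  sInf {m | ∃ F : Finset Y, F.card = m ∧ P ⊆ ⋃ x ∈ F, dynBall d f n ε x}

/-- `Λ_φ(α,ε) = lim_{δ→0} liminf_n (1/n) log N(α,δ,n,ε)` (a monotone limit, hence an
infimum over `δ > 0`). -/
def LambdaEps (d : Y → Y → ℝ) (f : Y → Y) (φ : Y → ℝ) (α ε : ℝ) : EReal :=
  ⨅ (δ : ℝ) (_ : 0 < δ),
    Filter.liminf (fun n : ℕ =>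
      ((Real.log (coverMinCard d f n ε (Pset f φ α δ n)) / n : ℝ) : EReal)) Filter.atTop

/-- `Λ_φ mdim_M(f,α,d) = limsup_{ε→0} Λ_φ(α,ε)/|log ε|`. -/
def LambdaMdim (d : Y → Y → ℝ) (f : Y → Y) (φ : Y → ℝ) (α : ℝ) : EReal :=
  Filter.limsup (fun ε : ℝ => LambdaEps d f φ α ε * (((|Real.log ε|)⁻¹ : ℝ) : EReal))
    (nhdsWithin (0 : ℝ) (Set.Ioi 0))

/-- A finite Borel partition of `X`. -/
structure FinBorelPartition (X : Type*) [MeasurableSpace X] where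
  parts : Finset (Set X)
  meas : ∀ s ∈ parts, MeasurableSet s
  cover : ∀ x : X, ∃ s ∈ parts, x ∈ s
  disj : ∀ s ∈ parts, ∀ t ∈ parts, s ≠ t → Disjoint s t

/-- The dynamical refinement `ξ^n = ⋁_{j=0}^{n−1} f^{−j} ξ` of a finite family of sets. -/
def dynRefine {X : Type*} (f : X → X) (P : Finset (Set X)) (n : ℕ) : Finset (Set X) :=
  letI := Classical.decEq (Set X)
  ((Finset.range n).pi fun _ => P).image fun c =>
    ⋂ (j : ℕ) (h : j ∈ Finset.range n), f^[j] ⁻¹' c j h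

/-- Entropy `H_μ(P) = Σ_C −μ(C) log μ(C)` of a finite family of sets. -/
def partEntropy {X : Type*} [MeasurableSpace X] (μ : Measure X) (P : Finset (Set X)) : ℝ :=
  ∑ s ∈ P, Real.negMulLog (μ s).toReal

/-- `h_μ(f,ξ) = lim_n (1/n) H_μ(ξ^n)`. -/
def dynEntropy {X : Type*} [MeasurableSpace X] (f : X → X) (μ : Measure X)
    (ξ : FinBorelPartition X) : ℝ :=
  Filter.limsup (fun n : ℕ => partEntropy μ (dynRefine f ξ.parts n) / n) Filter.atTop

/-- `H_φ mdim_M(f,α,d)`. -/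
def HphiMdim {X : Type*} [MetricSpace X] [MeasurableSpace X] (f : X → X) (φ : X → ℝ)
    (α : ℝ) : EReal :=
  Filter.limsup (fun ε : ℝ =>
    (⨆ (μ : ProbabilityMeasure X)
        (_ : Measure.map f (μ : Measure X) = (μ : Measure X) ∧
             ∫ x, φ x ∂(μ : Measure X) = α),
      ⨅ (ξ : FinBorelPartition X) (_ : ∀ s ∈ ξ.parts, Metric.diam s < ε),
        ((dynEntropy f (μ : Measure X) ξ : ℝ) : EReal)) * (((|Real.log ε|)⁻¹ : ℝ) : EReal))
    (nhdsWithin (0 : ℝ) (Set.Ioi 0))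

/-- The specification property. -/
def SpecificationProperty {X : Type*} [MetricSpace X] (f : X → X) : Prop :=
  ∀ ε : ℝ, 0 < ε → ∃ m : ℕ, ∀ (k : ℕ) (a b : Fin k → ℕ) (x : Fin k → X),
    (∀ j, a j ≤ b j) →
    (∀ (j : ℕ) (h : j + 1 < k), b ⟨j, Nat.lt_of_succ_lt h⟩ + m ≤ a ⟨j + 1, h⟩) →
    ∃ y : X, ∀ (j : Fin k) (p : ℕ), p ≤ b j - a j →
      dist (f^[p + a j] y) (f^[p] (x j)) < ε


/-- The distance function of a metric space, as a plain function. -/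
def mDist (X : Type*) [MetricSpace X] : X → X → ℝ := fun x y => dist x y

end

noncomputable section

/-- The `ℓ^p(ν)` distance between two real sequences. -/
def lpwDist (p : ℝ) (ν : ℕ → ℝ) (x y : ℕ → ℝ) : ℝ :=
  (∑' n : ℕ, |x n - y n| ^ p * ν n) ^ (1 / p)

/-- The backward shift on real sequences. -/
def shiftSeq (x : ℕ → ℝ) : ℕ → ℝ := fun n => x (n + 1)

/-- The set `K = {x : |x_n| ≤ 1 for all n}`. -/
def Kball : Set (ℕ → ℝ) := {x : ℕ → ℝ | ∀ n, |x n| ≤ 1}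

end

/-- The grid set `S` used in the lower bound of Lemma 4.1: sequences in `K` whose first `n`
coordinates lie in the grid `{0, ε/ν_1^{1/p}, …, ⌊ν_1^{1/p}/ε⌋ · ε/ν_1^{1/p}}` and whose
remaining coordinates vanish.  (Sequences are indexed from `0`, so `ν 0` plays the role of
`ν_1`.) -/
def Sgrid (p ε : ℝ) (ν : ℕ → ℝ) (n : ℕ) : Set (ℕ → ℝ) :=
  {x ∈ Kball |
    (∀ i < n, ∃ k : ℕ, k ≤ ⌊(ν 0) ^ (1 / p) / ε⌋₊ ∧ x i = k * (ε / (ν 0) ^ (1 / p))) ∧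
    ∀ i, n ≤ i → x i = 0}

theorem shiftSeq_iterate (x : ℕ → ℝ) (j n : ℕ) : shiftSeq^[j] x n = x (n + j) := by
  induction j generalizing n with
  | zero => rfl
  | succ k ih =>
    rw [Function.iterate_succ_apply', shiftSeq, ih]
    congr 1
    omega

theorem shiftSeq_iterate_mem_Kball {x : ℕ → ℝ} (hx : x ∈ Kball) (j : ℕ) :
    shiftSeq^[j] x ∈ Kball := fun n => by
  rw [shiftSeq_iterate]
  exact hx _

theorem abs_sub_le_two_of_mem_Kball {x y : ℕ → ℝ} (hx : x ∈ Kball) (hy : y ∈ Kball) (n : ℕ) :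
    |x n - y n| ≤ 2 := by
  have h1 := abs_sub (x n) (y n)
  linarith [hx n, hy n]

theorem lpwDist_term_nonneg {p : ℝ} {ν : ℕ → ℝ} (hν : ∀ n, 0 < ν n) (x y : ℕ → ℝ) (n : ℕ) :
    0 ≤ |x n - y n| ^ p * ν n :=
  mul_nonneg (Real.rpow_nonneg (abs_nonneg _) _) (hν n).le

theorem lpwDist_term_le {p : ℝ} (hp : 0 ≤ p) {ν : ℕ → ℝ} (hν : ∀ n, 0 < ν n) {x y : ℕ → ℝ}
    (hx : x ∈ Kball) (hy : y ∈ Kball) (n : ℕ) :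
    |x n - y n| ^ p * ν n ≤ 2 ^ p * ν n :=
  mul_le_mul_of_nonneg_right
    (Real.rpow_le_rpow (abs_nonneg _) (abs_sub_le_two_of_mem_Kball hx hy n) hp) (hν n).le

theorem summable_lpwDist_term {p : ℝ} (hp : 0 ≤ p) {ν : ℕ → ℝ} (hν : ∀ n, 0 < ν n)
    (hsum : Summable ν) {x y : ℕ → ℝ} (hx : x ∈ Kball) (hy : y ∈ Kball) :
    Summable fun n => |x n - y n| ^ p * ν n :=
  Summable.of_nonneg_of_le (lpwDist_term_nonneg hν x y) (lpwDist_term_le hp hν hx hy)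
    (hsum.mul_left _)

theorem abs_sub_zero_mul_le_lpwDist {p : ℝ} (hp : 0 < p) {ν : ℕ → ℝ} (hν : ∀ n, 0 < ν n)
    (hsum : Summable ν) {x y : ℕ → ℝ} (hx : x ∈ Kball) (hy : y ∈ Kball) :
    |x 0 - y 0| * ν 0 ^ (1 / p) ≤ lpwDist p ν x y := by
  have h := (summable_lpwDist_term hp.le hν hsum hx hy).le_tsum 0
    fun n _ => lpwDist_term_nonneg hν x y n
  have h2 := Real.rpow_le_rpow (lpwDist_term_nonneg hν x y 0) h (one_div_pos.2 hp).le
  rwa [Real.mul_rpow (Real.rpow_nonneg (abs_nonneg _) _) (hν 0).le, ← Real.rpow_mul (abs_nonneg _),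
    mul_one_div_cancel hp.ne', Real.rpow_one] at h2

theorem abs_sub_mul_le_dynDist {p : ℝ} (hp : 0 < p) {ν : ℕ → ℝ} (hν : ∀ n, 0 < ν n)
    (hsum : Summable ν) {x y : ℕ → ℝ} (hx : x ∈ Kball) (hy : y ∈ Kball) {i n : ℕ} (hi : i < n) :
    |x i - y i| * ν 0 ^ (1 / p) ≤ dynDist (lpwDist p ν) shiftSeq n x y := by
  have h := abs_sub_zero_mul_le_lpwDist hp hν hsum (shiftSeq_iterate_mem_Kball hx i)
    (shiftSeq_iterate_mem_Kball hy i)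
  simp only [shiftSeq_iterate, zero_add] at h
  exact h.trans (le_ciSup (f := fun j : Fin n =>
    lpwDist p ν (shiftSeq^[(j : ℕ)] x) (shiftSeq^[(j : ℕ)] y)) (Set.finite_range _).bddAbove ⟨i, hi⟩)

theorem exists_lpwDist_le {p : ℝ} (hp : 0 < p) {ν : ℕ → ℝ} (hν : ∀ n, 0 < ν n)
    (hsum : Summable ν) {ε : ℝ} (hε : 0 < ε) :
    ∃ N : ℕ, ∃ η : ℝ, 0 < η ∧ ∀ x ∈ Kball, ∀ y ∈ Kball,
      (∀ i < N, |x i - y i| ≤ η) → lpwDist p ν x y ≤ ε := by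
  have hT : 0 ≤ ∑' n, ν n := tsum_nonneg fun n => (hν n).le
  have hεp : 0 < ε ^ p := Real.rpow_pos_of_pos hε p
  have h2p : (0 : ℝ) < 2 ^ p := Real.rpow_pos_of_pos two_pos p
  obtain ⟨N, hN⟩ := ((tendsto_sum_nat_add ν).eventually
    (gt_mem_nhds (show 0 < ε ^ p / 2 / 2 ^ p by positivity))).exists
  have hA : 0 < ε ^ p / (2 * (∑' n, ν n + 1)) := by positivity
  refine ⟨N, (ε ^ p / (2 * (∑' n, ν n + 1))) ^ (1 / p), Real.rpow_pos_of_pos hA _, ?_⟩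
  intro x hx y hy hxy
  have hs := summable_lpwDist_term hp.le hν hsum hx hy
  have hhead : ∑ i ∈ Finset.range N, |x i - y i| ^ p * ν i ≤ ε ^ p / 2 := by
    calc ∑ i ∈ Finset.range N, |x i - y i| ^ p * ν i
        ≤ ∑ i ∈ Finset.range N, ε ^ p / (2 * (∑' n, ν n + 1)) * ν i := by
          refine Finset.sum_le_sum fun i hi => mul_le_mul_of_nonneg_right ?_ (hν i).le
          have h := Real.rpow_le_rpow (abs_nonneg _) (hxy i (Finset.mem_range.1 hi)) hp.le
          rwa [← Real.rpow_mul hA.le, one_div_mul_cancel hp.ne', Real.rpow_one] at h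
      _ = ε ^ p / (2 * (∑' n, ν n + 1)) * ∑ i ∈ Finset.range N, ν i := by rw [Finset.mul_sum]
      _ ≤ ε ^ p / (2 * (∑' n, ν n + 1)) * (∑' n, ν n + 1) := by
          refine mul_le_mul_of_nonneg_left ?_ hA.le
          have := hsum.sum_le_tsum (Finset.range N) fun i _ => (hν i).le
          linarith
      _ = ε ^ p / 2 := by field_simp
  have htail : ∑' i, |x (i + N) - y (i + N)| ^ p * ν (i + N) ≤ ε ^ p / 2 := by
    calc ∑' i, |x (i + N) - y (i + N)| ^ p * ν (i + N)
        ≤ ∑' i, 2 ^ p * ν (i + N) :=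
          Summable.tsum_le_tsum (fun i => lpwDist_term_le hp.le hν hx hy (i + N))
            ((summable_nat_add_iff N).2 hs) (((summable_nat_add_iff N).2 hsum).mul_left _)
      _ = 2 ^ p * ∑' i, ν (i + N) := tsum_mul_left
      _ ≤ 2 ^ p * (ε ^ p / 2 / 2 ^ p) := mul_le_mul_of_nonneg_left hN.le h2p.le
      _ = ε ^ p / 2 := by field_simp
  have hle : ∑' n, |x n - y n| ^ p * ν n ≤ ε ^ p := by
    rw [← hs.sum_add_tsum_nat_add N]
    linarith
  have h := Real.rpow_le_rpow (tsum_nonneg (lpwDist_term_nonneg hν x y)) hle (one_div_pos.2 hp).le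
  rwa [← Real.rpow_mul hε.le, mul_one_div_cancel hp.ne', Real.rpow_one] at h

theorem bddAbove_card_isDynSep {p : ℝ} (hp : 0 < p) {ν : ℕ → ℝ} (hν : ∀ n, 0 < ν n)
    (hsum : Summable ν) {ε : ℝ} (hε : 0 < ε) (n : ℕ) :
    BddAbove {m | ∃ E : Finset (ℕ → ℝ), ↑E ⊆ Kball ∧
      IsDynSep (lpwDist p ν) shiftSeq n ε ↑E ∧ E.card = m} := by
  obtain ⟨N, η, hη, h⟩ := exists_lpwDist_le hp hν hsum hε
  refine ⟨(Fintype.piFinset fun _ : Fin (n + N) => Finset.Icc ⌊-1 / η⌋ ⌊1 / η⌋).card, ?_⟩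
  rintro _ ⟨E, hEK, hE, rfl⟩
  refine Finset.card_le_card_of_injOn (fun x i => ⌊x i / η⌋) ?_ ?_
  · intro x hx
    simp only [Finset.mem_coe, Fintype.mem_piFinset, Finset.mem_Icc]
    intro i
    have hxi := abs_le.1 (hEK hx i)
    exact ⟨Int.floor_le_floor (div_le_div_of_nonneg_right hxi.1 hη.le),
      Int.floor_le_floor (div_le_div_of_nonneg_right hxi.2 hη.le)⟩
  · intro x hx y hy hxy
    by_contra hne
    refine (hE hx hy hne).not_ge (Real.iSup_le (fun j => ?_) hε.le)
    refine h _ (shiftSeq_iterate_mem_Kball (hEK hx) _) _ (shiftSeq_iterate_mem_Kball (hEK hy) _) ?_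
    intro i hi
    rw [shiftSeq_iterate, shiftSeq_iterate]
    have hfl := Int.abs_sub_lt_one_of_floor_eq_floor
      (congrFun hxy ⟨i + j, by have := j.2; omega⟩)
    rw [← sub_div, abs_div, abs_of_pos hη, div_lt_one hη] at hfl
    exact hfl.le

theorem Sgrid_eq_range {p ε : ℝ} {ν : ℕ → ℝ} (hν : 0 < ν 0) (hε : 0 < ε) (n : ℕ) :
    Sgrid p ε ν n = Set.range fun (f : Fin n → Fin (⌊ν 0 ^ (1 / p) / ε⌋₊ + 1)) (i : ℕ) =>
      if h : i < n then ((f ⟨i, h⟩ : ℕ) : ℝ) * (ε / ν 0 ^ (1 / p)) else 0 := by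
  have hc : 0 < ν 0 ^ (1 / p) := Real.rpow_pos_of_pos hν _
  ext x
  constructor
  · rintro ⟨-, hx, hx0⟩
    choose k hk hxk using hx
    refine ⟨fun i => ⟨k i i.2, Nat.lt_succ_of_le (hk i i.2)⟩, ?_⟩
    ext i
    by_cases hi : i < n
    · simp [hi, hxk i hi]
    · simp [hi, hx0 i (not_lt.1 hi)]
  · rintro ⟨f, rfl⟩
    refine ⟨fun i => ?_, fun i hi => ⟨f ⟨i, hi⟩, Nat.le_of_lt_succ (f ⟨i, hi⟩).2, by simp [hi]⟩,
      fun i hi => by simp [not_lt.2 hi]⟩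
    by_cases hi : i < n
    · simp only [hi, dif_pos]
      rw [abs_of_nonneg (by positivity), ← mul_div_assoc, div_le_one hc, ← le_div_iff₀ hε]
      exact (Nat.le_floor_iff (by positivity)).1 (Nat.le_of_lt_succ (f ⟨i, hi⟩).2)
    · simp [hi]

theorem finite_Sgrid {p ε : ℝ} {ν : ℕ → ℝ} (hν : 0 < ν 0) (hε : 0 < ε) (n : ℕ) :
    (Sgrid p ε ν n).Finite := by
  rw [Sgrid_eq_range hν hε]
  exact Set.finite_range _

theorem ncard_Sgrid {p ε : ℝ} {ν : ℕ → ℝ} (hν : 0 < ν 0) (hε : 0 < ε) (n : ℕ) :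
    (Sgrid p ε ν n).ncard = (⌊ν 0 ^ (1 / p) / ε⌋₊ + 1) ^ n := by
  have hc : 0 < ν 0 ^ (1 / p) := Real.rpow_pos_of_pos hν _
  rw [Sgrid_eq_range hν hε, ← Nat.card_coe_set_eq, Nat.card_range_of_injective]
  · simp
  · intro f g hfg
    ext i
    have h := congrFun hfg i
    simp only [i.2, dif_pos] at h
    exact_mod_cast mul_right_cancel₀ (div_pos hε hc).ne' h

theorem le_dynDist_of_mem_Sgrid {p : ℝ} (hp : 0 < p) {ν : ℕ → ℝ} (hν : ∀ n, 0 < ν n)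
    (hsum : Summable ν) {ε : ℝ} (hε : 0 < ε) {n : ℕ} {x y : ℕ → ℝ} (hx : x ∈ Sgrid p ε ν n)
    (hy : y ∈ Sgrid p ε ν n) (hxy : x ≠ y) :
    ε ≤ dynDist (lpwDist p ν) shiftSeq n x y := by
  have hc : 0 < ν 0 ^ (1 / p) := Real.rpow_pos_of_pos (hν 0) _
  obtain ⟨i, hi⟩ := Function.ne_iff.1 hxy
  have hin : i < n := by
    by_contra hni
    exact hi ((hx.2.2 i (not_lt.1 hni)).trans (hy.2.2 i (not_lt.1 hni)).symm)
  refine le_trans ?_ (abs_sub_mul_le_dynDist hp hν hsum hx.1 hy.1 hin)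
  obtain ⟨k, -, hk⟩ := hx.2.1 i hin
  obtain ⟨l, -, hl⟩ := hy.2.1 i hin
  have hkl : (k : ℤ) - l ≠ 0 := by
    intro h0
    have : k = l := by omega
    exact hi (by rw [hk, hl, this])
  have h1 : (1 : ℝ) ≤ |(k : ℝ) - l| := by exact_mod_cast Int.one_le_abs hkl
  rw [hk, hl, ← sub_mul, abs_mul, abs_of_pos (div_pos hε hc), mul_assoc,
    div_mul_cancel₀ _ hc.ne']
  nlinarith

theorem pow_le_sepMaxCard {p : ℝ} (hp : 0 < p) {ν : ℕ → ℝ} (hν : ∀ n, 0 < ν n)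
    (hsum : Summable ν) {ε : ℝ} (hε : 0 < ε) (n : ℕ) :
    (ν 0 ^ (1 / p) / (2 * ε)) ^ n ≤ (sepMaxCard (lpwDist p ν) shiftSeq n ε Kball : ℝ) := by
  have h2ε : 0 < 2 * ε := by positivity
  have hc : 0 < ν 0 ^ (1 / p) := Real.rpow_pos_of_pos (hν 0) _
  have hfin := finite_Sgrid (p := p) (hν 0) h2ε n
  have hle : (⌊ν 0 ^ (1 / p) / (2 * ε)⌋₊ + 1) ^ n
      ≤ sepMaxCard (lpwDist p ν) shiftSeq n ε Kball := by
    refine le_csSup (bddAbove_card_isDynSep hp hν hsum hε n) ⟨hfin.toFinset, ?_, ?_, ?_⟩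
    · intro x hx
      exact (hfin.mem_toFinset.1 hx).1
    · intro x hx y hy hxy
      have := le_dynDist_of_mem_Sgrid hp hν hsum h2ε (hfin.mem_toFinset.1 hx)
        (hfin.mem_toFinset.1 hy) hxy
      linarith
    · rw [← Set.ncard_eq_toFinset_card _ hfin, ncard_Sgrid (hν 0) h2ε]
  calc (ν 0 ^ (1 / p) / (2 * ε)) ^ n
      ≤ ((⌊ν 0 ^ (1 / p) / (2 * ε)⌋₊ : ℝ) + 1) ^ n :=
        pow_le_pow_left₀ (by positivity) (Nat.lt_floor_add_one _).le n
    _ ≤ _ := by exact_mod_cast hle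

theorem log_le_hSep {p : ℝ} (hp : 0 < p) {ν : ℕ → ℝ} (hν : ∀ n, 0 < ν n)
    (hsum : Summable ν) {ε : ℝ} (hε : 0 < ε) :
    ((Real.log (ν 0 ^ (1 / p) / (2 * ε)) : ℝ) : EReal)
      ≤ hSep (lpwDist p ν) shiftSeq Kball ε := by
  have hc : 0 < ν 0 ^ (1 / p) := Real.rpow_pos_of_pos (hν 0) _
  refine Filter.le_limsup_of_frequently_le (Filter.Eventually.frequently ?_)
  filter_upwards [Filter.eventually_gt_atTop 0] with n hn
  have hn' : (0 : ℝ) < n := by exact_mod_cast hn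
  rw [EReal.coe_le_coe_iff, le_div_iff₀ hn', mul_comm, ← Real.log_pow]
  exact Real.log_le_log (by positivity) (pow_le_sepMaxCard hp hν hsum hε n)

theorem tendsto_log_div_mul_inv_abs_log {c : ℝ} (hc : 0 < c) :
    Filter.Tendsto (fun ε : ℝ => Real.log (c / ε) * |Real.log ε|⁻¹)
      (nhdsWithin 0 (Set.Ioi 0)) (nhds 1) := by
  have habs : Filter.Tendsto (fun ε : ℝ => |Real.log ε|⁻¹) (nhdsWithin 0 (Set.Ioi 0)) (nhds 0) :=
    (Filter.tendsto_abs_atBot_atTop.comp Real.tendsto_log_nhdsGT_zero).inv_tendsto_atTop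
  have h : Filter.Tendsto (fun ε : ℝ => Real.log c * |Real.log ε|⁻¹ + 1)
      (nhdsWithin 0 (Set.Ioi 0)) (nhds 1) := by
    simpa using (habs.const_mul (Real.log c)).add_const 1
  refine h.congr' ?_
  filter_upwards [Ioo_mem_nhdsGT (zero_lt_one' ℝ)] with ε hε
  have hlog : Real.log ε < 0 := Real.log_neg hε.1 hε.2
  rw [Real.log_div hc.ne' hε.1.ne', abs_of_neg hlog]
  field_simp [hlog.ne]
  ring

/-- Lower bound in Lemma 4.1: for `0 < ε ≤ ν_1^{1/p}` the grid set `S` has cardinality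
`(⌊ν_1^{1/p}/ε⌋ + 1)^n` and its distinct points are at `d_n`-distance `≥ ε`; consequently
`mdim_M(K,σ,‖·‖_{ℓ^p(ν)}) ≥ 1`. -/
theorem mdim_shift_on_K_lower_bound (p : ℝ) (hp : 1 ≤ p) (ν : ℕ → ℝ)
    (hν : ∀ n, 0 < ν n) (hsum : Summable ν) :
    (∀ ε : ℝ, 0 < ε → ε ≤ (ν 0) ^ (1 / p) → ∀ n : ℕ,
      (Sgrid p ε ν n).Finite ∧
      (Sgrid p ε ν n).ncard = (⌊(ν 0) ^ (1 / p) / ε⌋₊ + 1) ^ n ∧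
      ∀ x ∈ Sgrid p ε ν n, ∀ y ∈ Sgrid p ε ν n, x ≠ y →
        ε ≤ dynDist (lpwDist p ν) shiftSeq n x y) ∧
    (1 : EReal) ≤ mdimSep (lpwDist p ν) shiftSeq Kball := by
  have hp0 : 0 < p := one_pos.trans_le hp
  have hc : 0 < ν 0 ^ (1 / p) := Real.rpow_pos_of_pos (hν 0) _
  refine ⟨fun ε hε _ n => ⟨finite_Sgrid (hν 0) hε n, ncard_Sgrid (hν 0) hε n,
    fun x hx y hy hxy => le_dynDist_of_mem_Sgrid hp0 hν hsum hε hx hy hxy⟩, ?_⟩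
  have hlim := (continuous_coe_real_ereal.tendsto 1).comp
    (tendsto_log_div_mul_inv_abs_log (half_pos hc))
  rw [← EReal.coe_one, ← hlim.limsup_eq]
  refine Filter.limsup_le_limsup ?_
  filter_upwards [self_mem_nhdsWithin] with ε hε
  have h := log_le_hSep hp0 hν hsum hε
  rw [← div_div] at h
  simp only [Function.comp_apply, EReal.coe_mul]
  exact mul_le_mul_of_nonneg_right h (EReal.coe_nonneg.2 (by positivity))
end

section
/- Fix 1 ≤ p < ∞ and a sequence ν = (ν_n)_{n∈ℕ} of positive reals with Σ_{n=1}^∞ ν_n < ∞, and let σ and K be the backward shift and the set {x ∈ ℓ^p(ν) : |x_n| ≤ 1 ∀n}. Set M = (Σ_{k=1}^∞ ν_k)^{1/p}. Then for every ε > 0 one has h(σ|_K, ε) ≤ log(2⌊12M/ε⌋ + 1), and consequently mdim_M(K, σ, ‖·‖_{ℓ^p(ν)}) ≤ 1. -/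
open Filter Set MeasureTheory
open scoped ENNReal NNReal Topology

theorem shiftSeq_iterate_apply (j : ℕ) (x : ℕ → ℝ) (n : ℕ) :
    shiftSeq^[j] x n = x (n + j) := by
  induction j generalizing x with
  | zero => rfl
  | succ j ih =>
    rw [Function.iterate_succ_apply, ih]
    simp only [shiftSeq]
    congr 1

theorem lpwDist_le_of_forall_lt {p : ℝ} (hp : 1 ≤ p) {ν : ℕ → ℝ} (hν : ∀ n, 0 < ν n)
    (hsum : Summable ν) {x y : ℕ → ℝ} (hx : x ∈ Kball) (hy : y ∈ Kball) {L : ℕ} {δ ε : ℝ}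
    (hδ : 0 ≤ δ) (hε : 0 ≤ ε) (hclose : ∀ n < L, |x n - y n| ≤ δ)
    (hL : δ ^ p * ∑' n, ν n + 2 ^ p * ∑' n, ν (n + L) ≤ ε ^ p) :
    lpwDist p ν x y ≤ ε := by
  have hp0 : 0 < p := by linarith
  have hterm : ∀ n, |x n - y n| ^ p * ν n ≤ 2 ^ p * ν n := fun n => by
    have h1 := abs_le.1 (hx n)
    have h2 := abs_le.1 (hy n)
    have : |x n - y n| ≤ 2 := abs_le.2 ⟨by linarith, by linarith⟩
    have := (hν n).le
    gcongr
  have hnn : ∀ n, 0 ≤ |x n - y n| ^ p * ν n := fun n => by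
    have := (hν n).le
    positivity
  have hs : Summable fun n => |x n - y n| ^ p * ν n :=
    Summable.of_nonneg_of_le hnn hterm (hsum.mul_left _)
  have hhead : ∑ n ∈ Finset.range L, |x n - y n| ^ p * ν n ≤ δ ^ p * ∑' n, ν n := by
    calc ∑ n ∈ Finset.range L, |x n - y n| ^ p * ν n
        ≤ ∑ n ∈ Finset.range L, δ ^ p * ν n := by
          refine Finset.sum_le_sum fun n hn => ?_
          have := hclose n (Finset.mem_range.1 hn)
          have := (hν n).le
          gcongr
      _ = δ ^ p * ∑ n ∈ Finset.range L, ν n := by rw [Finset.mul_sum]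
      _ ≤ δ ^ p * ∑' n, ν n := by
          gcongr
          exact hsum.sum_le_tsum _ fun n _ => (hν n).le
  have htail : ∑' n, |x (n + L) - y (n + L)| ^ p * ν (n + L) ≤ 2 ^ p * ∑' n, ν (n + L) := by
    rw [← tsum_mul_left]
    exact Summable.tsum_le_tsum (fun n => hterm (n + L)) ((summable_nat_add_iff L).2 hs)
      (((summable_nat_add_iff L).2 hsum).mul_left _)
  have htot : ∑' n, |x n - y n| ^ p * ν n ≤ ε ^ p := by
    rw [← hs.sum_add_tsum_nat_add L]
    linarith
  unfold lpwDist
  calc (∑' n, |x n - y n| ^ p * ν n) ^ (1 / p) ≤ (ε ^ p) ^ (1 / p) := by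
        have : 0 ≤ ∑' n, |x n - y n| ^ p * ν n := tsum_nonneg hnn
        gcongr
    _ = ε := by rw [← Real.rpow_mul hε, mul_one_div_cancel hp0.ne', Real.rpow_one]

/-- The interval `[-1, 1]` splits into `q` cells of diameter at most `2 / q`. -/
theorem exists_fin_coding (q : ℕ) (hq : 0 < q) :
    ∃ c : ℝ → Fin q, ∀ s t : ℝ, |s| ≤ 1 → |t| ≤ 1 → c s = c t → |s - t| ≤ 2 / q := by
  have hq' : (0 : ℝ) < q := by exact_mod_cast hq
  refine ⟨fun t => ⟨min ⌊(t + 1) / 2 * q⌋₊ (q - 1), by omega⟩, fun s t hs ht h => ?_⟩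
  have bounds : ∀ t : ℝ, |t| ≤ 1 →
      ((min ⌊(t + 1) / 2 * q⌋₊ (q - 1) : ℕ) : ℝ) ≤ (t + 1) / 2 * q ∧
      (t + 1) / 2 * q ≤ ((min ⌊(t + 1) / 2 * q⌋₊ (q - 1) : ℕ) : ℝ) + 1 := by
    intro t ht
    obtain ⟨h1, h2⟩ := abs_le.1 ht
    have h0 : 0 ≤ (t + 1) / 2 * q := mul_nonneg (by linarith) hq'.le
    refine ⟨le_trans (by exact_mod_cast min_le_left _ _) (Nat.floor_le h0), ?_⟩
    rcases min_choice ⌊(t + 1) / 2 * q⌋₊ (q - 1) with h | h <;> rw [h]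
    · exact (Nat.lt_floor_add_one _).le
    · rw [Nat.cast_pred hq, sub_add_cancel]
      exact mul_le_of_le_one_left hq'.le (by linarith)
  have hst := congrArg (fun i : Fin q => ((i : ℕ) : ℝ)) h
  simp only at hst
  obtain ⟨hs1, hs2⟩ := bounds s hs
  obtain ⟨ht1, ht2⟩ := bounds t ht
  rw [hst] at hs1 hs2
  rw [abs_le, le_div_iff₀ hq', ← neg_div, div_le_iff₀ hq']
  constructor <;> linarith

theorem sepMaxCard_shiftSeq_le {p : ℝ} (hp : 1 ≤ p) {ν : ℕ → ℝ} (hν : ∀ n, 0 < ν n)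
    (hsum : Summable ν) {ε : ℝ} (hε : 0 < ε) {q : ℕ} (hq : 0 < q)
    (hqε : 2 / q * (∑' k, ν k) ^ (1 / p) < ε) :
    ∃ L : ℕ, ∀ n, sepMaxCard (lpwDist p ν) shiftSeq n ε Kball ≤ q ^ (n + L) := by
  have hp0 : 0 < p := by linarith
  have hT : 0 ≤ ∑' k, ν k := tsum_nonneg fun n => (hν n).le
  have hδ : (0 : ℝ) ≤ 2 / q := by positivity
  have hlt : (2 / q : ℝ) ^ p * ∑' k, ν k < ε ^ p := by
    have := Real.rpow_lt_rpow (by positivity) hqε hp0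
    rwa [Real.mul_rpow hδ (by positivity), ← Real.rpow_mul hT, one_div_mul_cancel hp0.ne',
      Real.rpow_one] at this
  obtain ⟨L, hL⟩ : ∃ L, (2 / q : ℝ) ^ p * ∑' k, ν k + 2 ^ p * ∑' n, ν (n + L) ≤ ε ^ p := by
    have ht : Tendsto (fun L => (2 / q : ℝ) ^ p * ∑' k, ν k + 2 ^ p * ∑' n, ν (n + L)) atTop
        (𝓝 ((2 / q : ℝ) ^ p * ∑' k, ν k + 2 ^ p * 0)) :=
      ((tendsto_sum_nat_add ν).const_mul _).const_add _
    rw [mul_zero, add_zero] at ht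
    exact ((ht.eventually_lt_const hlt).exists).imp fun _ h => h.le
  obtain ⟨c, hc⟩ := exists_fin_coding q hq
  refine ⟨L, fun n => csSup_le' ?_⟩
  rintro m ⟨E, hEK, hE, rfl⟩
  have hinj : Set.InjOn (fun (x : ℕ → ℝ) (i : Fin (n + L)) => c (x i)) E := by
    intro x hx y hy hxy
    by_contra hne
    refine (hE hx hy hne).not_ge (Real.iSup_le (fun j => ?_) hε.le)
    refine lpwDist_le_of_forall_lt hp hν hsum (shiftSeq_iterate_mem_Kball (hEK hx) j)
      (shiftSeq_iterate_mem_Kball (hEK hy) j) hδ hε.le (fun k hk => ?_) hL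
    rw [shiftSeq_iterate_apply, shiftSeq_iterate_apply]
    exact hc _ _ (hEK hx _) (hEK hy _) (congrFun hxy ⟨k + j, by omega⟩)
  calc E.card ≤ (Finset.univ : Finset (Fin (n + L) → Fin q)).card :=
        Finset.card_le_card_of_injOn _ (fun _ _ => Finset.mem_coe.2 (Finset.mem_univ _)) hinj
    _ = q ^ (n + L) := by simp

theorem hSep_le_log_of_sepMaxCard_le {Y : Type*} {d : Y → Y → ℝ} {f : Y → Y} {P : Set Y} {ε : ℝ}
    {q L : ℕ} (hq : 0 < q) (h : ∀ n, sepMaxCard d f n ε P ≤ q ^ (n + L)) :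
    hSep d f P ε ≤ ((Real.log q : ℝ) : EReal) := by
  have hq1 : (1 : ℝ) ≤ q := by exact_mod_cast hq
  have hlog : 0 ≤ Real.log q := Real.log_nonneg hq1
  have hlim : Tendsto (fun n : ℕ => Real.log q + L * Real.log q / n) atTop (𝓝 (Real.log q)) := by
    simpa using (tendsto_const_div_atTop_nhds_zero_nat (L * Real.log q)).const_add (Real.log q)
  rw [hSep, ← (EReal.tendsto_coe.2 hlim).limsup_eq]
  refine limsup_le_limsup ?_
  filter_upwards [eventually_gt_atTop 0] with n hn
  have hn' : (0 : ℝ) < n := by exact_mod_cast hn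
  rw [EReal.coe_le_coe_iff, div_le_iff₀ hn', add_mul, div_mul_cancel₀ _ hn'.ne']
  have hle : Real.log (sepMaxCard d f n ε P) ≤ (n + L) * Real.log q := by
    rcases Nat.eq_zero_or_pos (sepMaxCard d f n ε P) with h0 | h0
    · rw [h0, Nat.cast_zero, Real.log_zero]
      positivity
    · calc Real.log (sepMaxCard d f n ε P) ≤ Real.log ((q : ℝ) ^ (n + L)) :=
            Real.log_le_log (by exact_mod_cast h0) (by exact_mod_cast h n)
        _ = (n + L) * Real.log q := by rw [Real.log_pow]; push_cast; ring
  linarith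

theorem mdimSep_le_one_of_hSep_le_log {Y : Type*} {d : Y → Y → ℝ} {f : Y → Y} {P : Set Y} {A : ℝ}
    (hA : 0 ≤ A)
    (h : ∀ ε : ℝ, 0 < ε → hSep d f P ε ≤ ((Real.log ((2 * ⌊A / ε⌋₊ + 1 : ℕ) : ℝ) : ℝ) : EReal)) :
    mdimSep d f P ≤ 1 := by
  have habs : Tendsto (fun ε : ℝ => |Real.log ε|) (𝓝[>] 0) atTop :=
    tendsto_abs_atBot_atTop.comp Real.tendsto_log_nhdsGT_zero
  have hlim : Tendsto (fun ε : ℝ => Real.log (2 * A + 1) * |Real.log ε|⁻¹ + 1) (𝓝[>] 0) (𝓝 1) := by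
    simpa using (habs.inv_tendsto_atTop.const_mul (Real.log (2 * A + 1))).add_const 1
  rw [mdimSep, ← EReal.coe_one, ← (EReal.tendsto_coe.2 hlim).limsup_eq]
  refine limsup_le_limsup ?_
  filter_upwards [self_mem_nhdsWithin, nhdsWithin_le_nhds (Iio_mem_nhds one_pos)] with ε hε hε1
  rw [Set.mem_Ioi] at hε
  rw [Set.mem_Iio] at hε1
  have hlogneg : Real.log ε < 0 := Real.log_neg hε hε1
  have hpos : 0 < |Real.log ε| := abs_pos.2 hlogneg.ne
  have hreal : Real.log ((2 * ⌊A / ε⌋₊ + 1 : ℕ) : ℝ) ≤ Real.log (2 * A + 1) + |Real.log ε| := by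
    rw [abs_of_neg hlogneg, ← sub_eq_add_neg, ← Real.log_div (by positivity) hε.ne']
    refine Real.log_le_log (by positivity) ?_
    have h1 : (⌊A / ε⌋₊ : ℝ) ≤ A / ε := Nat.floor_le (by positivity)
    have h2 : 1 ≤ 1 / ε := (one_le_div hε).2 hε1.le
    push_cast
    rw [add_div, mul_div_assoc]
    linarith
  calc hSep d f P ε * ((|Real.log ε|⁻¹ : ℝ) : EReal)
      ≤ ((Real.log (2 * A + 1) + |Real.log ε| : ℝ) : EReal) * ((|Real.log ε|⁻¹ : ℝ) : EReal) :=
        mul_le_mul_of_nonneg_right ((h ε hε).trans (EReal.coe_le_coe_iff.2 hreal))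
          (EReal.coe_nonneg.2 (inv_nonneg.2 hpos.le))
    _ = ((Real.log (2 * A + 1) * |Real.log ε|⁻¹ + 1 : ℝ) : EReal) := by
        rw [← EReal.coe_mul, add_mul, mul_inv_cancel₀ hpos.ne']

/-- Upper bound in Lemma 4.1: with `M = (Σ_k ν_k)^{1/p}`, for every `ε > 0` one has
`h(σ|_K, ε) ≤ log(2⌊12M/ε⌋ + 1)`; consequently `mdim_M(K,σ,‖·‖_{ℓ^p(ν)}) ≤ 1`. -/
theorem mdim_shift_on_K_upper_bound (p : ℝ) (hp : 1 ≤ p) (ν : ℕ → ℝ)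
    (hν : ∀ n, 0 < ν n) (hsum : Summable ν) :
    (∀ ε : ℝ, 0 < ε →
      hSep (lpwDist p ν) shiftSeq Kball ε ≤
        ((Real.log ((2 * ⌊12 * (∑' k : ℕ, ν k) ^ (1 / p) / ε⌋₊ + 1 : ℕ) : ℝ) : ℝ) : EReal)) ∧
    mdimSep (lpwDist p ν) shiftSeq Kball ≤ 1 := by
  have hM : 0 ≤ (∑' k, ν k) ^ (1 / p) := Real.rpow_nonneg (tsum_nonneg fun n => (hν n).le) _
  have hbound : ∀ ε : ℝ, 0 < ε → hSep (lpwDist p ν) shiftSeq Kball ε ≤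
      ((Real.log ((2 * ⌊12 * (∑' k : ℕ, ν k) ^ (1 / p) / ε⌋₊ + 1 : ℕ) : ℝ) : ℝ) : EReal) := by
    intro ε hε
    have hq : 0 < 2 * ⌊12 * (∑' k : ℕ, ν k) ^ (1 / p) / ε⌋₊ + 1 := Nat.succ_pos _
    have hqε : 2 / ((2 * ⌊12 * (∑' k : ℕ, ν k) ^ (1 / p) / ε⌋₊ + 1 : ℕ) : ℝ) *
        (∑' k, ν k) ^ (1 / p) < ε := by
      rw [div_mul_eq_mul_div, div_lt_iff₀ (by exact_mod_cast hq)]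
      have hfl := Nat.lt_floor_add_one (12 * (∑' k : ℕ, ν k) ^ (1 / p) / ε)
      rw [div_lt_iff₀ hε] at hfl
      push_cast
      have : 0 ≤ (⌊12 * (∑' k : ℕ, ν k) ^ (1 / p) / ε⌋₊ : ℝ) * ε := by positivity
      linarith
    obtain ⟨L, hL⟩ := sepMaxCard_shiftSeq_le hp hν hsum hε hq hqε
    exact hSep_le_log_of_sepMaxCard_le hq hL
  exact ⟨hbound, mdimSep_le_one_of_hSep_le_log (by positivity) hbound⟩
end

section
/- Fix 1 ≤ p < ∞ and a bounded sequence of nonzero scalars w = (w_n)_{n∈ℕ}, let B_w be the weighted backward shift on ℓ^p, set ν̄_n = 1/∏_{j=2}^n |w_j|^p (with ν̄_1 = 1), and assume Σ_{n=1}^∞ ν̄_n < ∞. Let a_1 = 1, a_n = w_2⋯w_n, and φ_a: ℓ^p → ℓ^p(ν̄), φ_a((x_n)) = (a_n x_n). With K̄ = {x ∈ ℓ^p(ν̄) : |x_n| ≤ 1 ∀n} and K̄_m = mK̄, the sets φ_a^{−1}(K̄_m) are compact B_w-invariant subsets of ℓ^p, and for every m ∈ ℕ the upper metric mean dimension of B_w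 restricted to φ_a^{−1}(K̄_m) with respect to the ℓ^p-norm metric equals 1: mdim_M(φ_a^{−1}(K̄_m), B_w, ‖·‖_{ℓ^p}) = 1. -/
open Filter Set MeasureTheory
open scoped ENNReal NNReal Topology

/-- The weighted backward shift `B_w` on real sequences (sequences indexed from `0`). -/
def BwMap (w : ℕ → ℝ) (x : ℕ → ℝ) : ℕ → ℝ := fun i => w (i + 1) * x (i + 1)

/-- The conjugating map `φ_a(x) = (a_n x_n)_n`. -/
def phiaMap (a : ℕ → ℝ) (x : ℕ → ℝ) : ℕ → ℝ := fun i => a i * x i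

/-- The scaled set `K̄_m = m·K̄ ⊆ ℓ^p(ν̄)`. -/
def Kscaled (m : ℕ) : Set (ℕ → ℝ) := (fun x : ℕ → ℝ => (m : ℝ) • x) '' Kball

section WeightedShift

variable {Y : Type*} {w a νb : ℕ → ℝ} {p : ℝ} {m : ℕ}

theorem mem_preimage_Kscaled_iff (hm : 0 < m) (x : ℕ → ℝ) :
    x ∈ phiaMap a ⁻¹' Kscaled m ↔ ∀ i, |a i * x i| ≤ m := by
  have hm' : (0 : ℝ) < m := by exact_mod_cast hm
  constructor
  · rintro ⟨z, hz, hzx⟩ i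
    have h : (m : ℝ) * z i = a i * x i := congrFun hzx i
    rw [← h, abs_mul, abs_of_pos hm']
    exact mul_le_of_le_one_right hm'.le (hz i)
  · intro h
    refine ⟨fun i => (m : ℝ)⁻¹ * (a i * x i), fun i => ?_, ?_⟩
    · rw [abs_mul, abs_of_pos (inv_pos.2 hm'), inv_mul_le_iff₀ hm', mul_one]
      exact h i
    · funext i
      simp [phiaMap, hm'.ne']

theorem mul_BwMap_iterate (ha : ∀ i, a i = ∏ k ∈ Finset.range i, w (k + 1)) (j : ℕ) :
    ∀ (x : ℕ → ℝ) (i : ℕ), a i * ((BwMap w)^[j] x) i = a (i + j) * x (i + j) := by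
  induction j with
  | zero => intro x i; rfl
  | succ j ih =>
    intro x i
    rw [Function.iterate_succ_apply, ih, BwMap, ← mul_assoc, ← add_assoc]
    congr 1
    rw [ha (i + j + 1), Finset.prod_range_succ, ← ha]

theorem prod_weights_ne_zero (hw0 : ∀ i, w i ≠ 0)
    (ha : ∀ i, a i = ∏ k ∈ Finset.range i, w (k + 1)) (i : ℕ) : a i ≠ 0 := by
  rw [ha]
  exact Finset.prod_ne_zero_iff.2 fun k _ => hw0 _

theorem inv_weights_eq (ha : ∀ i, a i = ∏ k ∈ Finset.range i, w (k + 1))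
    (hνb : ∀ i, νb i = (∏ k ∈ Finset.range i, |w (k + 1)| ^ p)⁻¹) (i : ℕ) :
    νb i = (|a i| ^ p)⁻¹ := by
  rw [hνb, ha, Finset.abs_prod, Real.finsetProd_rpow _ _ fun k _ => abs_nonneg _]

theorem abs_sub_rpow_eq (ha0 : ∀ i, a i ≠ 0) (hν : ∀ i, νb i = (|a i| ^ p)⁻¹)
    (x y : ℕ → ℝ) (i : ℕ) :
    |x i - y i| ^ p = |a i * x i - a i * y i| ^ p * νb i := by
  have h : 0 < |a i| ^ p := Real.rpow_pos_of_pos (abs_pos.2 (ha0 i)) p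
  rw [← mul_sub, abs_mul, Real.mul_rpow (abs_nonneg _) (abs_nonneg _), hν]
  field_simp

theorem weight_pos (ha0 : ∀ i, a i ≠ 0) (hν : ∀ i, νb i = (|a i| ^ p)⁻¹) (i : ℕ) :
    0 < νb i := by
  rw [hν]
  exact inv_pos.2 (Real.rpow_pos_of_pos (abs_pos.2 (ha0 i)) p)

theorem lpwDist_one_eq (ha0 : ∀ i, a i ≠ 0) (hν : ∀ i, νb i = (|a i| ^ p)⁻¹) (x y : ℕ → ℝ) :
    lpwDist p (fun _ => 1) x y = (∑' i, |a i * x i - a i * y i| ^ p * νb i) ^ (1 / p) := by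
  simp only [lpwDist, mul_one, abs_sub_rpow_eq ha0 hν]

theorem abs_sub_rpow_le (hp : 1 ≤ p) {s t M : ℝ} (hs : |s| ≤ M) (ht : |t| ≤ M) :
    |s - t| ^ p ≤ (2 * M) ^ p := by
  refine Real.rpow_le_rpow (abs_nonneg _) ?_ (by linarith)
  calc |s - t| ≤ |s| + |t| := abs_sub s t
    _ ≤ 2 * M := by linarith

theorem summable_weighted_diff (hp : 1 ≤ p) (hν0 : ∀ i, 0 < νb i) (hsum : Summable νb)
    {s t : ℕ → ℝ} {M : ℝ} (hs : ∀ i, |s i| ≤ M) (ht : ∀ i, |t i| ≤ M) :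
    Summable fun i => |s i - t i| ^ p * νb i :=
  Summable.of_nonneg_of_le
    (fun i => mul_nonneg (Real.rpow_nonneg (abs_nonneg _) _) (hν0 i).le)
    (fun i => mul_le_mul_of_nonneg_right (abs_sub_rpow_le hp (hs i) (ht i)) (hν0 i).le)
    (hsum.mul_left _)

theorem abs_zero_coord_le_lpwDist (hp : 1 ≤ p) (ha0 : ∀ i, a i ≠ 0) (ha1 : a 0 = 1)
    (hν : ∀ i, νb i = (|a i| ^ p)⁻¹) (hsum : Summable νb) {x y : ℕ → ℝ} {M : ℝ}
    (hx : ∀ i, |a i * x i| ≤ M) (hy : ∀ i, |a i * y i| ≤ M) :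
    |a 0 * x 0 - a 0 * y 0| ≤ lpwDist p (fun _ => 1) x y := by
  have hν0 := weight_pos ha0 hν
  have hp0 : p ≠ 0 := by linarith
  have hS := summable_weighted_diff hp hν0 hsum hx hy
  have h := hS.le_tsum 0 fun i _ => mul_nonneg (Real.rpow_nonneg (abs_nonneg _) _) (hν0 i).le
  have h1 : νb 0 = 1 := by simp [hν, ha1]
  rw [h1, mul_one] at h
  rw [lpwDist_one_eq ha0 hν]
  calc |a 0 * x 0 - a 0 * y 0| = (|a 0 * x 0 - a 0 * y 0| ^ p) ^ (1 / p) := by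
        rw [one_div, Real.rpow_rpow_inv (abs_nonneg _) hp0]
    _ ≤ _ := Real.rpow_le_rpow (Real.rpow_nonneg (abs_nonneg _) _) h (by positivity)

theorem lpwDist_le_of_close_coords (hp : 1 ≤ p) (ha0 : ∀ i, a i ≠ 0)
    (hν : ∀ i, νb i = (|a i| ^ p)⁻¹) (hsum : Summable νb) {x y : ℕ → ℝ} {M δ ε : ℝ}
    (hε : 0 ≤ ε) {N : ℕ}
    (hx : ∀ i, |a i * x i| ≤ M) (hy : ∀ i, |a i * y i| ≤ M)
    (hδ : δ ^ p * (∑' i, νb i) ≤ ε ^ p / 2)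
    (hN : (2 * M) ^ p * ∑' i, νb (i + N) ≤ ε ^ p / 2)
    (hδ0 : 0 ≤ δ) (hxy : ∀ i < N, |a i * x i - a i * y i| ≤ δ) :
    lpwDist p (fun _ => 1) x y ≤ ε := by
  have hν0 := weight_pos ha0 hν
  have hp0 : p ≠ 0 := by linarith
  have hS := summable_weighted_diff hp hν0 hsum hx hy
  have hhead : ∑ i ∈ Finset.range N, |a i * x i - a i * y i| ^ p * νb i ≤ ε ^ p / 2 := by
    calc ∑ i ∈ Finset.range N, |a i * x i - a i * y i| ^ p * νb i
        ≤ ∑ i ∈ Finset.range N, δ ^ p * νb i :=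
          Finset.sum_le_sum fun i hi => mul_le_mul_of_nonneg_right
            (Real.rpow_le_rpow (abs_nonneg _) (hxy i (Finset.mem_range.1 hi)) (by linarith))
            (hν0 i).le
      _ = δ ^ p * ∑ i ∈ Finset.range N, νb i := by rw [Finset.mul_sum]
      _ ≤ δ ^ p * ∑' i, νb i := mul_le_mul_of_nonneg_left
          (hsum.sum_le_tsum _ fun i _ => (hν0 i).le) (Real.rpow_nonneg hδ0 p)
      _ ≤ _ := hδ
  have htail : ∑' i, |a (i + N) * x (i + N) - a (i + N) * y (i + N)| ^ p * νb (i + N)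
      ≤ ε ^ p / 2 := by
    refine le_trans ?_ hN
    rw [← tsum_mul_left]
    exact Summable.tsum_le_tsum
      (fun i => mul_le_mul_of_nonneg_right (abs_sub_rpow_le hp (hx _) (hy _)) (hν0 _).le)
      ((summable_nat_add_iff N).2 hS) (((summable_nat_add_iff N).2 hsum).mul_left _)
  rw [lpwDist_one_eq ha0 hν]
  calc (∑' i, |a i * x i - a i * y i| ^ p * νb i) ^ (1 / p) ≤ (ε ^ p) ^ (1 / p) := by
        refine Real.rpow_le_rpow (tsum_nonneg fun i =>
          mul_nonneg (Real.rpow_nonneg (abs_nonneg _) _) (hν0 i).le) ?_ (by positivity)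
        rw [← hS.sum_add_tsum_nat_add N]
        linarith
    _ = ε := by rw [one_div, Real.rpow_rpow_inv hε hp0]

theorem sepMaxCard_le {d : Y → Y → ℝ} {f : Y → Y} {n : ℕ} {ε : ℝ} {P : Set Y} {B : ℕ}
    (h : ∀ E : Finset Y, ↑E ⊆ P → IsDynSep d f n ε ↑E → E.card ≤ B) :
    sepMaxCard d f n ε P ≤ B := by
  refine csSup_le ⟨0, ∅, by simp, by simp [IsDynSep], rfl⟩ ?_
  rintro _ ⟨E, hE, hsep, rfl⟩
  exact h E hE hsep

theorem le_sepMaxCard {d : Y → Y → ℝ} {f : Y → Y} {n : ℕ} {ε : ℝ} {P : Set Y} {B : ℕ}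
    (h : ∀ E : Finset Y, ↑E ⊆ P → IsDynSep d f n ε ↑E → E.card ≤ B) {E : Finset Y}
    (hE : ↑E ⊆ P) (hsep : IsDynSep d f n ε ↑E) : E.card ≤ sepMaxCard d f n ε P := by
  refine le_csSup ⟨B, ?_⟩ ⟨E, hE, hsep, rfl⟩
  rintro _ ⟨F, hF, hF', rfl⟩
  exact h F hF hF'

theorem le_dynDist (d : Y → Y → ℝ) (f : Y → Y) {n j : ℕ} (hj : j < n) (x y : Y) :
    d (f^[j] x) (f^[j] y) ≤ dynDist d f n x y :=
  le_ciSup (f := fun j : Fin n => d (f^[(j : ℕ)] x) (f^[(j : ℕ)] y))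
    (Set.finite_range _).bddAbove ⟨j, hj⟩

theorem card_le_of_isDynSep (hp : 1 ≤ p) (ha : ∀ i, a i = ∏ k ∈ Finset.range i, w (k + 1))
    (ha0 : ∀ i, a i ≠ 0) (hν : ∀ i, νb i = (|a i| ^ p)⁻¹) (hsum : Summable νb)
    {M δ ε : ℝ} (hε : 0 ≤ ε) {N : ℕ} (hδ : δ ^ p * (∑' i, νb i) ≤ ε ^ p / 2)
    (hN : (2 * M) ^ p * ∑' i, νb (i + N) ≤ ε ^ p / 2) (hδ0 : 0 < δ) (n : ℕ)
    (E : Finset (ℕ → ℝ)) (hE : ∀ x ∈ E, ∀ i, |a i * x i| ≤ M)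
    (hsep : IsDynSep (lpwDist p (fun _ => 1)) (BwMap w) n ε ↑E) :
    E.card ≤ (⌊2 * M / δ⌋₊ + 1) ^ (n + N) := by
  classical
  let g : (ℕ → ℝ) → (Fin (n + N) → Fin (⌊2 * M / δ⌋₊ + 1)) :=
    fun x i => Fin.ofNat _ ⌊(a i * x i + M) / δ⌋₊
  have hcard : (Finset.univ : Finset (Fin (n + N) → Fin (⌊2 * M / δ⌋₊ + 1))).card
      = (⌊2 * M / δ⌋₊ + 1) ^ (n + N) := by simp
  rw [← hcard]
  refine Finset.card_le_card_of_injOn g (fun _ _ => Finset.mem_coe.2 (Finset.mem_univ _)) ?_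
  intro x hx y hy hxy
  by_contra hne
  have hxM := hE x hx
  have hyM := hE y hy
  have hlt : ∀ z ∈ E, ∀ i, ⌊(a i * z i + M) / δ⌋₊ < ⌊2 * M / δ⌋₊ + 1 := by
    intro z hz i
    refine Nat.lt_succ_of_le (Nat.floor_le_floor ?_)
    have := (abs_le.1 (hE z hz i)).2
    gcongr
    linarith
  have hclose : ∀ i < n + N, |a i * x i - a i * y i| ≤ δ := by
    intro i hi
    have h := congrArg Fin.val (congrFun hxy ⟨i, hi⟩)
    simp only [g, Fin.ofNat, Nat.mod_eq_of_lt (hlt x hx i), Nat.mod_eq_of_lt (hlt y hy i)] at h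
    have hnn : ∀ z ∈ E, 0 ≤ (a i * z i + M) / δ := fun z hz =>
      div_nonneg (by linarith [(abs_le.1 (hE z hz i)).1]) hδ0.le
    have h1 := Nat.floor_le (hnn x hx)
    have h2 := Nat.lt_floor_add_one ((a i * x i + M) / δ)
    have h3 := Nat.floor_le (hnn y hy)
    have h4 := Nat.lt_floor_add_one ((a i * y i + M) / δ)
    rw [h] at h1 h2
    have h5 : |(a i * x i + M) / δ - (a i * y i + M) / δ| ≤ 1 :=
      abs_le.2 ⟨by linarith, by linarith⟩
    have h6 : (a i * x i + M) / δ - (a i * y i + M) / δ = (a i * x i - a i * y i) / δ := by ring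
    rwa [h6, abs_div, abs_of_pos hδ0, div_le_one hδ0] at h5
  refine absurd (hsep hx hy hne) (not_lt.2 (Real.iSup_le (fun j => ?_) hε))
  refine lpwDist_le_of_close_coords hp ha0 hν hsum (M := M) (N := N) hε ?_ ?_ hδ hN hδ0.le ?_
  · intro i; rw [mul_BwMap_iterate ha]; exact hxM _
  · intro i; rw [mul_BwMap_iterate ha]; exact hyM _
  · intro i hi
    rw [mul_BwMap_iterate ha, mul_BwMap_iterate ha]
    exact hclose _ (by omega)

theorem exists_isDynSep_card_eq (hp : 1 ≤ p)
    (ha : ∀ i, a i = ∏ k ∈ Finset.range i, w (k + 1)) (ha0 : ∀ i, a i ≠ 0)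
    (hν : ∀ i, νb i = (|a i| ^ p)⁻¹) (hsum : Summable νb) {M ε : ℝ} (hM : 0 ≤ M) (hε : 0 < ε)
    (n : ℕ) :
    ∃ E : Finset (ℕ → ℝ), (∀ x ∈ E, ∀ i, |a i * x i| ≤ M) ∧
      IsDynSep (lpwDist p (fun _ => 1)) (BwMap w) n ε ↑E ∧
      E.card = (⌊M / (2 * ε)⌋₊ + 1) ^ n := by
  classical
  let g : (Fin n → Fin (⌊M / (2 * ε)⌋₊ + 1)) → ℕ → ℝ :=
    fun c i => if h : i < n then (a i)⁻¹ * (2 * ε * ((c ⟨i, h⟩ : ℕ) : ℝ)) else 0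
  have hg : ∀ c i (h : i < n), a i * g c i = 2 * ε * ((c ⟨i, h⟩ : ℕ) : ℝ) := by
    intro c i h
    simp only [g, h, dif_pos]
    exact mul_inv_cancel_left₀ (ha0 i) _
  have hgM : ∀ c i, |a i * g c i| ≤ M := by
    intro c i
    by_cases h : i < n
    · rw [hg c i h, abs_of_nonneg (by positivity)]
      have h1 : ((c ⟨i, h⟩ : ℕ) : ℝ) ≤ M / (2 * ε) :=
        (Nat.cast_le.2 (Nat.lt_succ_iff.1 (c ⟨i, h⟩).2)).trans (Nat.floor_le (by positivity))
      rwa [le_div_iff₀' (by positivity)] at h1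
    · simp [g, h, hM]
  have hinj : Function.Injective g := by
    intro c c' h
    funext i
    have h1 := hg c i i.2
    rw [h, hg c' i i.2] at h1
    have h2 := mul_left_cancel₀ (by positivity) h1
    exact Fin.ext (Nat.cast_injective h2).symm
  refine ⟨Finset.univ.image g, ?_, ?_, ?_⟩
  · simp only [Finset.mem_image, Finset.mem_univ, true_and, forall_exists_index]
    rintro _ c rfl
    exact hgM c
  · intro x hx y hy hne
    simp only [Finset.coe_image, Finset.coe_univ, Set.image_univ, Set.mem_range] at hx hy
    obtain ⟨c, rfl⟩ := hx
    obtain ⟨c', rfl⟩ := hy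
    obtain ⟨i, hi⟩ : ∃ i, c i ≠ c' i := by
      by_contra! h
      exact hne (congrArg g (funext h))
    refine lt_of_lt_of_le ?_ (le_dynDist _ _ i.2 _ _)
    refine lt_of_lt_of_le ?_ (abs_zero_coord_le_lpwDist hp ha0 (by simp [ha]) hν hsum (M := M)
      ?_ ?_)
    · rw [mul_BwMap_iterate ha, mul_BwMap_iterate ha, zero_add, hg c i i.2, hg c' i i.2,
        ← mul_sub, abs_mul, abs_of_pos (by positivity : 0 < 2 * ε)]
      have h1 : (1 : ℝ) ≤ |((c i : ℕ) : ℝ) - ((c' i : ℕ) : ℝ)| := by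
        have h2 : (1 : ℤ) ≤ |((c i : ℕ) : ℤ) - ((c' i : ℕ) : ℤ)| :=
          Int.one_le_abs (sub_ne_zero.2 fun h => hi (Fin.ext (by exact_mod_cast h)))
        exact_mod_cast h2
      calc ε < 2 * ε * 1 := by linarith
        _ ≤ _ := by gcongr
    · intro k; rw [mul_BwMap_iterate ha]; exact hgM _ _
    · intro k; rw [mul_BwMap_iterate ha]; exact hgM _ _
  · rw [Finset.card_image_of_injective _ hinj]
    simp

theorem tendsto_const_sub_log_mul_inv_abs_log (C : ℝ) :
    Tendsto (fun ε : ℝ => (C - Real.log ε) * |Real.log ε|⁻¹) (𝓝[>] 0) (𝓝 1) := by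
  have hlog : Tendsto (fun ε : ℝ => |Real.log ε|) (𝓝[>] 0) atTop :=
    tendsto_abs_atBot_atTop.comp Real.tendsto_log_nhdsGT_zero
  have h := (hlog.inv_tendsto_atTop.const_mul C).add_const 1
  rw [mul_zero, zero_add] at h
  refine h.congr' ?_
  filter_upwards [Real.tendsto_log_nhdsGT_zero.eventually_lt_atBot 0] with ε hε
  simp only [Pi.inv_apply]
  rw [abs_of_neg hε]
  field_simp [hε.ne]
  ring

theorem exists_nat_tail_le (νb : ℕ → ℝ) (C : ℝ) {η : ℝ} (hη : 0 < η) :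
    ∃ N : ℕ, C * ∑' i, νb (i + N) ≤ η := by
  have h := (tendsto_sum_nat_add νb).const_mul C
  rw [mul_zero] at h
  obtain ⟨N, hN⟩ := (h.eventually_lt_const hη).exists
  exact ⟨N, hN.le⟩

theorem hSep_le_log {d : Y → Y → ℝ} {f : Y → Y} {P : Set Y} {ε : ℝ} {L N : ℕ}
    (h : ∀ n, sepMaxCard d f n ε P ≤ L ^ (n + N)) :
    hSep d f P ε ≤ ((Real.log L : ℝ) : EReal) := by
  have hlim : Tendsto (fun n : ℕ => Real.log L + N * Real.log L / n) atTop (𝓝 (Real.log L)) := by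
    simpa using (tendsto_const_div_atTop_nhds_zero_nat (N * Real.log L)).const_add (Real.log L)
  have hlim' := (continuous_coe_real_ereal.tendsto _).comp hlim
  rw [hSep, ← hlim'.limsup_eq]
  refine limsup_le_limsup ?_
  filter_upwards [eventually_gt_atTop 0] with n hn
  have hn' : (0 : ℝ) < n := by exact_mod_cast hn
  have hlogL : 0 ≤ Real.log L := Real.log_natCast_nonneg L
  refine EReal.coe_le_coe_iff.2 ?_
  have h1 : Real.log (sepMaxCard d f n ε P) ≤ (n + N) * Real.log L := by
    rcases Nat.eq_zero_or_pos (sepMaxCard d f n ε P) with h0 | h0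
    · rw [h0, Nat.cast_zero, Real.log_zero]; positivity
    · calc Real.log (sepMaxCard d f n ε P) ≤ Real.log ((L : ℝ) ^ (n + N)) :=
            Real.log_le_log (by exact_mod_cast h0) (by exact_mod_cast h n)
        _ = _ := by rw [Real.log_pow]; push_cast; ring
  calc Real.log (sepMaxCard d f n ε P) / n ≤ (n + N) * Real.log L / n := by gcongr
    _ = _ := by field_simp

theorem log_le_hSep_s18 {d : Y → Y → ℝ} {f : Y → Y} {P : Set Y} {ε : ℝ} {L : ℕ} (hL : 1 ≤ L)
    (h : ∀ n, L ^ n ≤ sepMaxCard d f n ε P) :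
    ((Real.log L : ℝ) : EReal) ≤ hSep d f P ε := by
  have hlim : Tendsto (fun _ : ℕ => ((Real.log L : ℝ) : EReal)) atTop (𝓝 (Real.log L : ℝ)) :=
    tendsto_const_nhds
  rw [hSep, ← hlim.limsup_eq]
  refine limsup_le_limsup ?_
  filter_upwards [eventually_gt_atTop 0] with n hn
  have hn' : (0 : ℝ) < n := by exact_mod_cast hn
  refine EReal.coe_le_coe_iff.2 ?_
  rw [le_div_iff₀ hn', mul_comm, ← Real.log_pow]
  have hL' : (0 : ℝ) < L := by exact_mod_cast hL
  exact Real.log_le_log (by positivity) (by exact_mod_cast h n)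

theorem mdimSep_eq_one_of_log_bounds {d : Y → Y → ℝ} {f : Y → Y} {P : Set Y} {C₁ C₂ : ℝ}
    (h : ∀ᶠ ε in 𝓝[>] (0 : ℝ), ((C₁ - Real.log ε : ℝ) : EReal) ≤ hSep d f P ε ∧
      hSep d f P ε ≤ ((C₂ - Real.log ε : ℝ) : EReal)) :
    mdimSep d f P = 1 := by
  have hlim : ∀ C : ℝ, Tendsto (fun ε : ℝ => (((C - Real.log ε) * |Real.log ε|⁻¹ : ℝ) : EReal))
      (𝓝[>] 0) (𝓝 1) := fun C =>
    (continuous_coe_real_ereal.tendsto _).comp (tendsto_const_sub_log_mul_inv_abs_log C)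
  refine Tendsto.limsup_eq (tendsto_of_tendsto_of_tendsto_of_le_of_le' (hlim C₁) (hlim C₂) ?_ ?_)
  · filter_upwards [h] with ε hε
    rw [EReal.coe_mul]
    exact mul_le_mul_of_nonneg_right hε.1 (by exact_mod_cast inv_nonneg.2 (abs_nonneg _))
  · filter_upwards [h] with ε hε
    rw [EReal.coe_mul]
    exact mul_le_mul_of_nonneg_right hε.2 (by exact_mod_cast inv_nonneg.2 (abs_nonneg _))

theorem mdimSep_BwMap_eq_one (hp : 1 ≤ p) (ha : ∀ i, a i = ∏ k ∈ Finset.range i, w (k + 1))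
    (ha0 : ∀ i, a i ≠ 0) (hν : ∀ i, νb i = (|a i| ^ p)⁻¹) (hsum : Summable νb) {M : ℝ}
    (hM : 0 < M) :
    mdimSep (lpwDist p (fun _ => 1)) (BwMap w) {x | ∀ i, |a i * x i| ≤ M} = 1 := by
  have hp0 : p ≠ 0 := by linarith
  have hν0 := weight_pos ha0 hν
  set S := ∑' i, νb i with hS_def
  have hS : 0 < S := hsum.tsum_pos (fun i => (hν0 i).le) 0 (hν0 0)
  set κ : ℝ := (2 * S)⁻¹ ^ (1 / p) with hκ_def
  have hκ : 0 < κ := Real.rpow_pos_of_pos (by positivity) _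
  have hκp : κ ^ p = (2 * S)⁻¹ := by
    rw [hκ_def, one_div, Real.rpow_inv_rpow (by positivity) hp0]
  refine mdimSep_eq_one_of_log_bounds (C₁ := Real.log (M / 2))
    (C₂ := Real.log (2 * M / κ + 1)) ?_
  filter_upwards [Ioo_mem_nhdsGT (zero_lt_one' ℝ)] with ε ⟨hε, hε1⟩
  obtain ⟨N, hN⟩ := exists_nat_tail_le νb ((2 * M) ^ p)
    (half_pos (Real.rpow_pos_of_pos hε p))
  have hδ : (κ * ε) ^ p * S ≤ ε ^ p / 2 := by
    rw [Real.mul_rpow hκ.le hε.le, hκp]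
    apply le_of_eq
    field_simp
  have hcard := card_le_of_isDynSep hp ha ha0 hν hsum hε.le hδ hN (mul_pos hκ hε)
  constructor
  · refine le_trans (EReal.coe_le_coe_iff.2 ?_)
      (log_le_hSep_s18 (L := ⌊M / (2 * ε)⌋₊ + 1) (Nat.le_add_left _ _) fun n => ?_)
    · rw [← Real.log_div (by positivity) hε.ne', div_div]
      exact Real.log_le_log (by positivity) (by exact_mod_cast (Nat.lt_floor_add_one _).le)
    · obtain ⟨E, hE, hsep, hEc⟩ := exists_isDynSep_card_eq hp ha ha0 hν hsum hM.le hε n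
      rw [← hEc]
      exact le_sepMaxCard (hcard n) hE hsep
  · refine le_trans (hSep_le_log fun n => sepMaxCard_le (hcard n))
      (EReal.coe_le_coe_iff.2 ?_)
    rw [← Real.log_div (by positivity) hε.ne']
    refine Real.log_le_log (by positivity) ?_
    push_cast
    calc (⌊2 * M / (κ * ε)⌋₊ : ℝ) + 1 ≤ 2 * M / (κ * ε) + 1 / ε :=
          add_le_add (Nat.floor_le (by positivity)) ((one_le_div hε).2 hε1.le)
      _ = _ := by field_simp

theorem exists_tendsto_lpwDist_subseq (hp : 1 ≤ p) (ha0 : ∀ i, a i ≠ 0)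
    (hν : ∀ i, νb i = (|a i| ^ p)⁻¹) (hsum : Summable νb) {M : ℝ} (u : ℕ → ℕ → ℝ)
    (hu : ∀ k i, |a i * u k i| ≤ M) :
    ∃ x : ℕ → ℝ, (∀ i, |a i * x i| ≤ M) ∧ ∃ ψ : ℕ → ℕ, StrictMono ψ ∧
      Tendsto (fun k => lpwDist p (fun _ => 1) (u (ψ k)) x) atTop (𝓝 0) := by
  have hν0 := weight_pos ha0 hν
  have hp0 : 0 < p := by linarith
  obtain ⟨y, hy, ψ, hψ, hlim⟩ :=
    (isCompact_univ_pi fun _ : ℕ => isCompact_Icc (a := -M) (b := M)).isSeqCompact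
      (x := fun k i => a i * u k i) fun k i _ => abs_le.1 (hu k i)
  have hya : ∀ i, a i * ((a i)⁻¹ * y i) = y i := fun i => mul_inv_cancel_left₀ (ha0 i) _
  have hyM : ∀ i, |y i| ≤ M := fun i => abs_le.2 (hy i (Set.mem_univ i))
  refine ⟨fun i => (a i)⁻¹ * y i, fun i => by rw [hya]; exact hyM i, ψ, hψ, ?_⟩
  simp only [lpwDist_one_eq ha0 hν, hya]
  have hcoord := tendsto_pi_nhds.1 hlim
  have hT : Tendsto (fun k => ∑' i, |a i * u (ψ k) i - y i| ^ p * νb i) atTop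
      (𝓝 (∑' _ : ℕ, (0 : ℝ))) := by
    refine tendsto_tsum_of_dominated_convergence (bound := fun i => (2 * M) ^ p * νb i)
      (hsum.mul_left _) (fun i => ?_) (Eventually.of_forall fun k i => ?_)
    · have h1 : Tendsto (fun k => |a i * u (ψ k) i - y i|) atTop (𝓝 0) := by
        simpa using ((hcoord i).sub_const (y i)).abs
      have h2 := (h1.rpow_const (Or.inr hp0.le) (p := p)).mul_const (νb i)
      rwa [Real.zero_rpow hp0.ne', zero_mul] at h2
    · rw [Real.norm_of_nonneg (mul_nonneg (Real.rpow_nonneg (abs_nonneg _) _) (hν0 i).le)]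
      exact mul_le_mul_of_nonneg_right (abs_sub_rpow_le hp (hu _ _) (hyM i)) (hν0 i).le
  rw [tsum_zero] at hT
  have h3 := hT.rpow_const (p := 1 / p) (Or.inr (by positivity))
  rwa [Real.zero_rpow (by positivity)] at h3

end WeightedShift

/-- For the weighted backward shift `B_w` on `ℓ^p` with `Σ ν̄_n < ∞`, the sets
`φ_a^{-1}(K̄_m)` are compact (here: sequentially compact for the `ℓ^p` distance)
`B_w`-invariant, and the upper metric mean dimension of `B_w` on `φ_a^{-1}(K̄_m)` with
respect to the `ℓ^p`-norm metric equals `1`.  (The `ℓ^p` distance is `lpwDist p 1`.) -/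
theorem mdim_weighted_shift_eq_one (p : ℝ) (hp : 1 ≤ p)
    (w : ℕ → ℝ) (hw0 : ∀ i, w i ≠ 0) (hwb : ∃ Cw : ℝ, ∀ i, |w i| ≤ Cw)
    (a : ℕ → ℝ) (ha : ∀ i, a i = ∏ k ∈ Finset.range i, w (k + 1))
    (νb : ℕ → ℝ) (hνb : ∀ i, νb i = (∏ k ∈ Finset.range i, |w (k + 1)| ^ p)⁻¹)
    (hsum : Summable νb) (m : ℕ) (hm : 0 < m) :
    (BwMap w '' (phiaMap a ⁻¹' Kscaled m) ⊆ phiaMap a ⁻¹' Kscaled m) ∧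
    (∀ u : ℕ → ℕ → ℝ, (∀ k, u k ∈ phiaMap a ⁻¹' Kscaled m) →
      ∃ x ∈ phiaMap a ⁻¹' Kscaled m, ∃ ψ : ℕ → ℕ, StrictMono ψ ∧
        Filter.Tendsto (fun k => lpwDist p (fun _ => 1) (u (ψ k)) x) Filter.atTop (nhds 0)) ∧
    mdimSep (lpwDist p (fun _ => 1)) (BwMap w) (phiaMap a ⁻¹' Kscaled m) = 1 := by
  have hm' : (0 : ℝ) < m := by exact_mod_cast hm
  have ha0 := prod_weights_ne_zero hw0 ha
  have hν := inv_weights_eq ha hνb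
  have hset : phiaMap a ⁻¹' Kscaled m = {x | ∀ i, |a i * x i| ≤ m} :=
    Set.ext (mem_preimage_Kscaled_iff hm)
  rw [hset]
  refine ⟨?_, fun u hu => exists_tendsto_lpwDist_subseq hp ha0 hν hsum u hu,
    mdimSep_BwMap_eq_one hp ha ha0 hν hsum hm'⟩
  rintro _ ⟨x, hx, rfl⟩ i
  have h := mul_BwMap_iterate ha 1 x i
  rw [Function.iterate_one] at h
  rw [h]
  exact hx (i + 1)
end
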